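/- Let N ≥ 1 and let Ω be the standard symplectic form on ℝ^{2N}. Let V be a real symmetric 2N×2N matrix such that V is positive definite and the complex matrix V + iΩ is positive definite. Then, viewing the real matrices as complex matrices, one has the identity X_V (V + iΩ)⁻¹ X_V = V − iΩ. -/

import Mathlib

open Matrix
open scoped ComplexOrder

noncomputable section

/-- The standard symplectic form on `ℝ^(2N)`: block diagonal with `N` blocks `[[0,1],[-1,0]]`. -/
def symp (N : ℕ) : Matrix (Fin (2*N)) (Fin (2*N)) ℝ :=
  Matrix.of fun i j =>
    if i.val % 2 = 0 ∧ j.val = i.val + 1 then 1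
    else if j.val % 2 = 0 ∧ i.val = j.val + 1 then -1
    else 0

/-- View a real matrix as a complex matrix. -/
def cplx {n : Type*} (M : Matrix n n ℝ) : Matrix n n ℂ :=
  M.map (fun x => (x : ℂ))

/-- `V` is a bona fide quantum covariance matrix w.r.t. the symplectic form `Om`:
the complex matrix `V + i·Om` is positive semidefinite. -/
def BonaFide {n : Type*} [Fintype n] (V Om : Matrix n n ℝ) : Prop :=
  (cplx V + Complex.I • cplx Om).PosSemidef

/-- The (positive semidefinite) square root of a positive semidefinite real matrix,
via the continuous functional calculus. -/
def msqrt {n : Type*} [Fintype n] [DecidableEq n] (M : Matrix n n ℝ) : Matrix n n ℝ :=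
  cfc Real.sqrt M

/-- `X_V = V^{1/2} (I + A⁻²)^{1/2} V^{1/2}` where `A = V^{1/2} Ω V^{1/2}`. -/
def Xmat {n : Type*} [Fintype n] [DecidableEq n] (V Om : Matrix n n ℝ) : Matrix n n ℝ :=
  msqrt V * msqrt (1 + (msqrt V * Om * msqrt V)⁻¹ * (msqrt V * Om * msqrt V)⁻¹) * msqrt V

lemma symp_mul_symp (N : ℕ) : symp N * symp N = -1 := by
  ext i j
  rw [Matrix.mul_apply]
  have hp : (if i.val % 2 = 0 then i.val + 1 else i.val - 1) < 2 * N := by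
    have := i.isLt
    split_ifs <;> omega
  rw [Finset.sum_eq_single (⟨_, hp⟩ : Fin (2*N))]
  · simp only [symp, Matrix.of_apply, Matrix.neg_apply, Matrix.one_apply, Fin.ext_iff]
    have := i.isLt
    have := j.isLt
    split_ifs <;> first | omega | norm_num
  · intro k _ hk
    have hk' : k.val ≠ (if i.val % 2 = 0 then i.val + 1 else i.val - 1) := fun h => hk (Fin.ext h)
    have h0 : symp N i k = 0 := by
      simp only [symp, Matrix.of_apply]
      split_ifs at hk' ⊢ <;> first | omega | rfl
    rw [h0, zero_mul]
  · simp

lemma symp_transpose (N : ℕ) : (symp N)ᵀ = -symp N := by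
  ext i j
  simp only [symp, Matrix.of_apply, Matrix.transpose_apply, Matrix.neg_apply]
  split_ifs <;> first | omega | norm_num

section helpers
variable {n : Type*} [Fintype n] [DecidableEq n]

lemma cplx_mul (A B : Matrix n n ℝ) : cplx (A * B) = cplx A * cplx B :=
  Matrix.map_mul (f := Complex.ofRealHom)

lemma cplx_one : cplx (1 : Matrix n n ℝ) = 1 := by
  ext i j
  by_cases h : i = j <;> simp [cplx, Matrix.one_apply, h]

lemma cplx_add (A B : Matrix n n ℝ) : cplx (A + B) = cplx A + cplx B := by
  ext i j; simp [cplx]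

lemma cplx_conjTranspose (A : Matrix n n ℝ) : (cplx A)ᴴ = cplx Aᵀ := by
  ext i j; simp [cplx, Matrix.conjTranspose_apply]

lemma cplx_transpose (A : Matrix n n ℝ) : (cplx A)ᵀ = cplx Aᵀ := by
  ext i j; simp [cplx]

lemma cplx_neg (A : Matrix n n ℝ) : cplx (-A) = -cplx A := by
  ext i j; simp [cplx]

lemma posSemidef_of_cplx {A : Matrix n n ℝ} (h : (cplx A).PosSemidef) : A.PosSemidef := by
  refine Matrix.PosSemidef.of_dotProduct_mulVec_nonneg ?_ ?_
  · ext i j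
    have := congrFun (congrFun h.isHermitian i) j
    simpa [cplx, Matrix.conjTranspose_apply] using this
  · intro x
    have := h.dotProduct_mulVec_nonneg (fun i => (x i : ℂ))
    have e : star (fun i => (x i : ℂ)) ⬝ᵥ (cplx A *ᵥ fun i => (x i : ℂ))
        = ((star x ⬝ᵥ (A *ᵥ x) : ℝ) : ℂ) := by
      simp [dotProduct, mulVec, cplx]
    rw [e] at this
    exact_mod_cast this

lemma msqrt_mul_self {A : Matrix n n ℝ} (h : A.PosSemidef) : msqrt A * msqrt A = A := by
  have hs : IsSelfAdjoint A := h.isHermitian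
  unfold msqrt
  have hc : ContinuousOn Real.sqrt (spectrum ℝ A) := Real.continuous_sqrt.continuousOn
  rw [← cfc_mul Real.sqrt Real.sqrt A hc hc]
  conv_rhs => rw [← cfc_id ℝ A hs]
  refine cfc_congr fun x hx => ?_
  have := (Matrix.posSemidef_iff_isHermitian_and_spectrum_nonneg.1 h).2 hx
  simpa using Real.mul_self_sqrt this

lemma msqrt_transpose (A : Matrix n n ℝ) : (msqrt A)ᵀ = msqrt A := by
  have : IsSelfAdjoint (msqrt A) := cfc_predicate _ _
  have h := this.star_eq
  rwa [Matrix.star_eq_conjTranspose, Matrix.conjTranspose_eq_transpose_of_trivial] at h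

lemma msqrt_commute {A B : Matrix n n ℝ} (h : Commute A B) : Commute (msqrt A) B :=
  h.cfc_real _

lemma Xmat_identity_aux (V Om : Matrix n n ℝ) (hO : Om * Om = -1) (hOt : Omᵀ = -Om)
    (hV : V.PosDef) (hC : (cplx V + Complex.I • cplx Om).PosDef) :
    cplx (Xmat V Om) * (cplx V + Complex.I • cplx Om)⁻¹ * cplx (Xmat V Om)
      = cplx V - Complex.I • cplx Om := by
  have hSS := msqrt_mul_self hV.posSemidef
  have hSt := msqrt_transpose V
  unfold Xmat
  set S := msqrt V with hS
  have hSu : IsUnit S.det := by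
    have : IsUnit V.det := (Matrix.isUnit_iff_isUnit_det _).1 hV.isUnit
    rw [← hSS, Matrix.det_mul] at this
    exact isUnit_of_mul_isUnit_left this
  obtain ⟨T, hT⟩ : ∃ T, T = S⁻¹ := ⟨_, rfl⟩
  have hST : S * T = 1 := by rw [hT]; exact Matrix.mul_nonsing_inv _ hSu
  have hTS : T * S = 1 := by rw [hT]; exact Matrix.nonsing_inv_mul _ hSu
  have hTt : Tᵀ = T := by rw [hT, Matrix.transpose_nonsing_inv, hSt]
  obtain ⟨B, hB⟩ : ∃ B, B = T * Om * T := ⟨_, rfl⟩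
  have hBt : Bᵀ = -B := by
    rw [hB, Matrix.transpose_mul, Matrix.transpose_mul, hTt, hOt]; noncomm_ring
  have hSBS : S * B * S = Om := by
    rw [hB, show S * (T * Om * T) * S = (S * T) * Om * (T * S) by noncomm_ring, hST, hTS]; simp
  have hA : (S * Om * S)⁻¹ = -B := by
    apply Matrix.inv_eq_right_inv
    rw [hB, show S * Om * S * -(T * Om * T) = -(S * Om * (S * T) * Om * T) by noncomm_ring, hST,
      show -(S * Om * 1 * Om * T) = -(S * (Om * Om) * T) by noncomm_ring, hO]
    simp [hST]
  have hTVT : T * V * T = 1 := by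
    rw [← hSS, show T * (S * S) * T = (T * S) * (S * T) by noncomm_ring, hST, hTS, mul_one]
  rw [hA, neg_mul_neg]
  -- complex side
  obtain ⟨b, hb⟩ : ∃ b, b = Complex.I • cplx B := ⟨_, rfl⟩
  have hbb : b * b = -cplx (B * B) := by
    rw [hb, cplx_mul, smul_mul_smul_comm, Complex.I_mul_I, neg_one_smul]
  have hP : (1 + b).PosSemidef := by
    have := hC.posSemidef.mul_mul_conjTranspose_same (cplx T)
    rw [cplx_conjTranspose, hTt] at this
    convert this using 1
    rw [mul_add, add_mul, mul_smul_comm, smul_mul_assoc, ← cplx_mul, ← cplx_mul, ← cplx_mul,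
      ← cplx_mul, hTVT, ← hB, cplx_one, hb]
  have hQ : (1 - b).PosSemidef := by
    have := hP.transpose
    have e : 1 - b = (1 + b)ᵀ := by
      rw [Matrix.transpose_add, Matrix.transpose_one, hb, Matrix.transpose_smul, cplx_transpose,
        hBt, cplx_neg, smul_neg, sub_eq_add_neg]
    rw [e]
    exact this
  have hPQ : cplx (1 + B * B) = (1 + b) * (1 - b) := by
    rw [cplx_add, cplx_one, show (1 + b) * (1 - b) = 1 - b * b by noncomm_ring, hbb, sub_neg_eq_add]
  have hpsd : (1 + B * B).PosSemidef := by
    apply posSemidef_of_cplx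
    have h1 := hQ.mul_mul_conjTranspose_same (1 + b)
    have h2 := hP.mul_mul_conjTranspose_same (1 - b)
    rw [hP.isHermitian.eq] at h1
    rw [hQ.isHermitian.eq] at h2
    have h3 := (h1.add h2).smul (show (0:ℝ) ≤ 1/2 by norm_num)
    convert h3 using 1
    rw [hPQ, show (1 + b) * (1 - b) * (1 + b) + (1 - b) * (1 + b) * (1 - b)
      = (2:ℝ) • ((1 + b) * (1 - b)) by rw [two_smul]; noncomm_ring, smul_smul]
    norm_num
  have hGG := msqrt_mul_self hpsd
  have hGB : Commute (msqrt (1 + B * B)) B :=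
    msqrt_commute ((Commute.one_left B).add_left ((Commute.refl B).mul_left (Commute.refl B)))
  generalize msqrt (1 + B * B) = G at hGG hGB
  have hW : cplx V + Complex.I • cplx Om = cplx S * (1 + b) * cplx S := by
    rw [mul_add, add_mul, mul_one, ← cplx_mul, hSS, hb, mul_smul_comm, smul_mul_assoc,
      ← cplx_mul, ← cplx_mul, hSBS]
  have hW' : cplx V - Complex.I • cplx Om = cplx S * (1 - b) * cplx S := by
    rw [mul_sub, sub_mul, mul_one, ← cplx_mul, hSS, hb, mul_smul_comm, smul_mul_assoc,
      ← cplx_mul, ← cplx_mul, hSBS]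
  have hWu : IsUnit (cplx V + Complex.I • cplx Om).det :=
    (Matrix.isUnit_iff_isUnit_det _).1 hC.isUnit
  have hgb : cplx G * b = b * cplx G := by
    rw [hb, mul_smul_comm, smul_mul_assoc, ← cplx_mul, ← cplx_mul, hGB.eq]
  have hgg : cplx G * cplx G = (1 + b) * (1 - b) := by rw [← cplx_mul, hGG, hPQ]
  have hst : cplx S * cplx T = 1 := by rw [← cplx_mul, hST, cplx_one]
  have hts : cplx T * cplx S = 1 := by rw [← cplx_mul, hTS, cplx_one]
  rw [cplx_mul, cplx_mul]
  rw [hW'] 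
  rw [hW] at hWu ⊢
  generalize cplx S = s at *
  generalize cplx T = t at *
  generalize cplx G = g at *
  have hsu : IsUnit s.det := by
    have : IsUnit (s.det * t.det) := by rw [← Matrix.det_mul, hst]; simp
    exact isUnit_of_mul_isUnit_left this
  have hpu : IsUnit (1 + b).det := by
    rw [Matrix.det_mul, Matrix.det_mul] at hWu
    exact isUnit_of_mul_isUnit_right (isUnit_of_mul_isUnit_left hWu)
  have hsinv : s⁻¹ = t := Matrix.inv_eq_right_inv hst
  rw [Matrix.mul_inv_rev, Matrix.mul_inv_rev, hsinv]
  obtain ⟨q, hq⟩ : ∃ q, q = (1 + b)⁻¹ := ⟨_, rfl⟩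
  have hq1 : q * (1 + b) = 1 := by rw [hq]; exact Matrix.nonsing_inv_mul _ hpu
  have hq2 : (1 + b) * q = 1 := by rw [hq]; exact Matrix.mul_nonsing_inv _ hpu
  rw [← hq]
  have hgp : g * (1 + b) = (1 + b) * g := by rw [mul_add, add_mul, hgb]; simp
  have hgq : g * q = q * g := by
    calc g * q = (q * (1 + b)) * g * q := by rw [hq1, one_mul]
      _ = q * (g * (1 + b)) * q := by rw [hgp, mul_assoc q]
      _ = q * g * ((1 + b) * q) := by simp only [mul_assoc]
      _ = q * g := by rw [hq2, mul_one]
  calc s * g * s * (t * (q * t)) * (s * g * s)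
      = s * g * (s * t) * q * (t * s) * g * s := by simp only [mul_assoc]
    _ = s * (g * q) * g * s := by rw [hst, hts]; simp only [mul_assoc, mul_one, one_mul]
    _ = s * q * (g * g) * s := by rw [hgq]; simp only [mul_assoc]
    _ = s * (q * (1 + b)) * (1 - b) * s := by rw [hgg]; simp only [mul_assoc]
    _ = s * (1 - b) * s := by rw [hq1, mul_one]

end helpers

/-- the identity `X_V (V + iΩ)⁻¹ X_V = V − iΩ`. -/
theorem Xmat_inv_identity (N : ℕ) (hN : 1 ≤ N)
    (V : Matrix (Fin (2*N)) (Fin (2*N)) ℝ)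
    (hVsymm : V.IsSymm) (hVpd : V.PosDef)
    (hVpdC : (cplx V + Complex.I • cplx (symp N)).PosDef) :
    cplx (Xmat V (symp N)) * (cplx V + Complex.I • cplx (symp N))⁻¹ * cplx (Xmat V (symp N))
      = cplx V - Complex.I • cplx (symp N) := by
  exact Xmat_identity_aux V (symp N) (symp_mul_symp N) (symp_transpose N) hVpd hVpdC
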